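/- Let S be a proper dyadic subbase of X. (i) If x ∈ X and p ∈ 𝕋^ω satisfies x̃ ⊑ p, then S̄(p) = {x}. (ii) If p ∈ 𝕋^ω satisfies dom(p) = ℕ, then S̄(p) contains at most one point, i.e., it is either a singleton or empty. (Proposition 2.5(3),(4)) -/

import Mathlib

open Set Topology TopologicalSpace

/-- The three-element set 𝕋 = {0, 1, ⊥}. `digit b` is a digit (0 or 1), `bot` is ⊥. -/
inductive TT where
  | bot : TT
  | digit : Bool → TT
  deriving DecidableEq

/-- The topology on 𝕋 whose open sets are ∅, {0}, {1}, {0,1}, 𝕋. -/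
instance : TopologicalSpace TT :=
  generateFrom {{TT.digit false}, {TT.digit true}}

/-- The pointwise order ⊑ on 𝕋^ω (⊥ ⊑ 0, ⊥ ⊑ 1, digits incomparable). -/
def TLe (p q : ℕ → TT) : Prop := ∀ k (b : Bool), p k = TT.digit b → q k = TT.digit b

/-- Compatibility in 𝕋^ω: existence of a common upper bound. -/
def TCompat (p q : ℕ → TT) : Prop := ∃ r, TLe p r ∧ TLe q r

/-- dom(p) = the set of positions where p has a digit. -/
def Tdom (p : ℕ → TT) : Set ℕ := {k | p k ≠ TT.bot}

/-- p is a finite bottomed sequence (an element of 𝕋^*). -/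
def TFin (p : ℕ → TT) : Prop := (Tdom p).Finite

/-- The truncation p|_n. -/
def trunc (p : ℕ → TT) (n : ℕ) : ℕ → TT := fun k => if k < n then p k else TT.bot

/-- The pointwise least upper bound of two (compatible) bottomed sequences. -/
def tsup (d e : ℕ → TT) : ℕ → TT := fun k => if d k = TT.bot then e k else d k

/-- A dyadic subbase of X: a family of regular open sets, pairwise exteriors,
forming a subbase of the topology of X. -/
structure DyadicSubbase (X : Type*) [t : TopologicalSpace X] where
  S : ℕ → Bool → Set X
  regOpen : ∀ n a, S n a = interior (closure (S n a))
  compl : ∀ n, S n true = (closure (S n false))ᶜ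
  subbase : generateFrom {U | ∃ n a, U = S n a} = t

variable {X : Type*} [TopologicalSpace X]

open Classical in
/-- The embedding φ_S : X → 𝕋^ω. -/
noncomputable def phi (D : DyadicSubbase X) (x : X) : ℕ → TT := fun n =>
  if x ∈ D.S n false then TT.digit false
  else if x ∈ D.S n true then TT.digit true
  else TT.bot

/-- S(p) = ⋂_{k ∈ dom p} S_{k, p(k)}. -/
def Sint (D : DyadicSubbase X) (p : ℕ → TT) : Set X :=
  {x | ∀ k (b : Bool), p k = TT.digit b → x ∈ D.S k b}

/-- S̄(p) = ⋂_{k ∈ dom p} cl(S_{k, p(k)}). -/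
def SbarInt (D : DyadicSubbase X) (p : ℕ → TT) : Set X :=
  {x | ∀ k (b : Bool), p k = TT.digit b → x ∈ closure (D.S k b)}

/-- S is a proper dyadic subbase: cl(S(e)) = S̄(e) for all finite bottomed e. -/
def IsProperDS (D : DyadicSubbase X) : Prop :=
  ∀ e, TFin e → closure (Sint D e) = SbarInt D e

/-- ↑X̃ = {p : x̃ ⊑ p for some x}. -/
def upX (D : DyadicSubbase X) : Set (ℕ → TT) := {p | ∃ x, TLe (phi D x) p}

/-- 2^ω, the bottom-free sequences. -/
def twoOmega : Set (ℕ → TT) := {p | ∀ k, p k ≠ TT.bot}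

/-- K_S = {x̃|_m : x ∈ X, m ∈ ℕ}. -/
def KS (D : DyadicSubbase X) : Set (ℕ → TT) := {e | ∃ x m, e = trunc (phi D x) m}

/-- K̂_S = {p|_m : p ∈ ↑X̃, m ∈ ℕ}. -/
def KhatS (D : DyadicSubbase X) : Set (ℕ → TT) := {e | ∃ p ∈ upX D, ∃ m, e = trunc p m}

/-- I is an ideal of the subposet K of 𝕋^ω. -/
def IsIdealOf (K I : Set (ℕ → TT)) : Prop :=
  I ⊆ K ∧ I.Nonempty ∧ (∀ d ∈ I, ∀ e ∈ I, ∃ f ∈ I, TLe d f ∧ TLe e f) ∧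
    (∀ d ∈ K, ∀ e ∈ I, TLe d e → d ∈ I)

/-- p is the pointwise least upper bound of the set I in 𝕋^ω. -/
def IsSupOf (I : Set (ℕ → TT)) (p : ℕ → TT) : Prop :=
  ∀ k (b : Bool), p k = TT.digit b ↔ ∃ e ∈ I, e k = TT.digit b

/-- D_S ⊆ 𝕋^ω: least upper bounds of ideals of K_S. -/
def DS (D : DyadicSubbase X) : Set (ℕ → TT) := {p | ∃ I, IsIdealOf (KS D) I ∧ IsSupOf I p}

/-- D̂_S ⊆ 𝕋^ω: least upper bounds of ideals of K̂_S. -/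
def DhatS (D : DyadicSubbase X) : Set (ℕ → TT) := {p | ∃ I, IsIdealOf (KhatS D) I ∧ IsSupOf I p}

/-- The limit (non-compact) elements of a subdomain E of 𝕋^ω:
those with infinite domain. -/
def limitsOf (E : Set (ℕ → TT)) : Set (ℕ → TT) := {p ∈ E | (Tdom p).Infinite}

/-- The minimal elements of a subset A of 𝕋^ω. -/
def minOf (A : Set (ℕ → TT)) : Set (ℕ → TT) := {p ∈ A | ∀ q ∈ A, TLe q p → q = p}

/-- q is an immediate successor of p in the subposet K of 𝕋^ω. -/
def ImmSucc (K : Set (ℕ → TT)) (p q : ℕ → TT) : Prop :=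
  p ∈ K ∧ q ∈ K ∧ TLe p q ∧ p ≠ q ∧ ¬∃ r ∈ K, TLe p r ∧ p ≠ r ∧ TLe r q ∧ r ≠ q

/-- A Hausdorff space is adhesive if it has at least two points and the closures
of any two nonempty open sets intersect. -/
def Adhesive (Y : Type*) [TopologicalSpace Y] : Prop :=
  (∃ y z : Y, y ≠ z) ∧
    ∀ U V : Set Y, IsOpen U → IsOpen V → U.Nonempty → V.Nonempty →
      (closure U ∩ closure V).Nonempty

/-- A space is strongly nonadhesive if every open subspace is nonadhesive. -/
def StronglyNonadhesive (Y : Type*) [TopologicalSpace Y] : Prop :=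
  ∀ U : Set Y, IsOpen U → ¬ Adhesive U
theorem aux_dis (D : DyadicSubbase X) (x : X) (k : ℕ) (b : Bool) (h : x ∈ D.S k b) :
    x ∉ closure (D.S k (!b)) := by
  cases b with
  | true => rw [D.compl] at h; exact h
  | false =>
    have ho : IsOpen (D.S k false) := by rw [D.regOpen]; exact isOpen_interior
    intro hc
    obtain ⟨y, hy, hy2⟩ := mem_closure_iff.1 hc _ ho h
    simp only [Bool.not_false] at hy2
    rw [D.compl] at hy2
    exact hy2 (subset_closure hy)

theorem aux_cov (D : DyadicSubbase X) (x : X) (k : ℕ) (b : Bool) (h : x ∉ D.S k (!b)) :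
    x ∈ closure (D.S k b) := by
  cases b with
  | false =>
    simp only [Bool.not_false] at h
    rw [D.compl] at h; simpa using h
  | true =>
    simp only [Bool.not_true] at h
    rw [D.regOpen, interior_eq_compl_closure_compl, ← D.compl] at h
    simpa using h

theorem aux_phi (D : DyadicSubbase X) (x : X) (k : ℕ) (b : Bool) :
    phi D x k = TT.digit b ↔ x ∈ D.S k b := by
  have h1 : x ∈ D.S k true → x ∉ D.S k false :=
    fun h h' => aux_dis D x k true h (subset_closure h')
  unfold phi
  by_cases hf : x ∈ D.S k false <;> by_cases ht : x ∈ D.S k true <;> cases b <;>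
    simp_all

theorem aux_basis (D : DyadicSubbase X) (x : X) (U : Set X) (hU : IsOpen U) (hx : x ∈ U) :
    ∃ n, Sint D (trunc (phi D x) n) ⊆ U := by
  have hg : GenerateOpen {U | ∃ n a, U = D.S n a} U := by
    have h2 : IsOpen[generateFrom {U | ∃ n a, U = D.S n a}] U := by
      rw [D.subbase]; exact hU
    exact h2
  clear hU
  induction hg with
  | basic s hs =>
    obtain ⟨n, a, rfl⟩ := hs
    refine ⟨n + 1, fun y hy => hy n a ?_⟩
    simp [trunc, (aux_phi D x n a).2 hx]
  | univ => exact ⟨0, subset_univ _⟩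
  | inter s t _ _ ihs iht =>
    obtain ⟨n, hn⟩ := ihs hx.1
    obtain ⟨m, hm⟩ := iht hx.2
    refine ⟨max n m, fun y hy => ⟨hn fun k b hk => hy k b ?_, hm fun k b hk => hy k b ?_⟩⟩
    all_goals
      simp only [trunc] at hk ⊢
      split_ifs at hk
      rw [if_pos (by omega), hk]
  | sUnion s _ ih =>
    obtain ⟨t, ht, hxt⟩ := hx
    obtain ⟨n, hn⟩ := ih t ht hxt
    exact ⟨n, hn.trans (subset_sUnion_of_mem ht)⟩

theorem aux_main [T2Space X] (D : DyadicSubbase X) (hD : IsProperDS D) (x : X) (p : ℕ → TT)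
    (h : TLe (phi D x) p) : SbarInt D p = {x} := by
  refine Subset.antisymm (fun y hy => ?_) ?_
  · by_contra hne
    obtain ⟨U, V, hU, hV, hxU, hyV, hd⟩ := t2_separation (Ne.symm hne)
    obtain ⟨n, hn⟩ := aux_basis D x U hU hxU
    have hfin : TFin (trunc (phi D x) n) := by
      refine (finite_lt_nat n).subset fun k hk => ?_
      by_contra hkn
      exact hk (if_neg hkn)
    have hyc : y ∈ closure (Sint D (trunc (phi D x) n)) := by
      rw [hD _ hfin]
      intro k b hk
      simp only [trunc] at hk
      split_ifs at hk
      exact hy k b (h k b hk)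
    obtain ⟨z, hz, hz2⟩ := mem_closure_iff.1 hyc V hV hyV
    exact disjoint_left.1 hd (hn hz2) hz
  · rintro _ rfl k b hk
    refine aux_cov D _ k b fun hx => ?_
    have := h k _ ((aux_phi D _ k _).2 hx)
    rw [hk] at this
    cases b <;> simp at this

/-- Proposition 2.5(3),(4): (i) if x̃ ⊑ p then S̄(p) = {x};
(ii) if dom(p) = ℕ then S̄(p) has at most one point. -/
theorem stmt_4 {X : Type*} [TopologicalSpace X] [T2Space X] [SecondCountableTopology X]
    (D : DyadicSubbase X) (hD : IsProperDS D) :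
    (∀ (x : X) (p : ℕ → TT), TLe (phi D x) p → SbarInt D p = {x}) ∧
    (∀ p : ℕ → TT, (∀ k, p k ≠ TT.bot) → (SbarInt D p).Subsingleton) := by
  refine ⟨fun x p h => aux_main D hD x p h, fun p hp x hx y hy => ?_⟩
  have h : TLe (phi D x) p := by
    intro k b hk
    have hxk := (aux_phi D x k b).1 hk
    cases hpk : p k with
    | bot => exact absurd hpk (hp k)
    | digit c =>
      by_cases hc : c = b
      · rw [hc]
      · have hc' : c = !b := by cases b <;> cases c <;> simp_all
        exact absurd (hc' ▸ hx k c hpk) (aux_dis D x k b hxk)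
  rw [aux_main D hD x p h] at hy
  exact (mem_singleton_iff.1 hy).symm
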